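/- The derivative of the interpolating cubic spline at the grid nodes is the Hermitian derivative of the grid values: if s is the type-I cubic spline interpolating u ∈ l²_{h,0}, then s′(x_0) = s′(x_N) = 0 and (1/6)·s′(x_{j−1}) + (2/3)·s′(x_j) + (1/6)·s′(x_{j+1}) = (u_{j+1} − u_{j−1})/(2h) for every 1 ≤ j ≤ N−1; that is, the grid function (s′(x_0), …, s′(x_N)) equals the Hermitian derivative u_x of u. -/

import Mathlib

open Set

/-- `IsHermDeriv N u v`: `v` is the Hermitian derivative of the grid function
`u ∈ l²_{h,0}` (with `h = 1/N`): `v 0 = v N = 0` and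
`(1/6) v_{j-1} + (2/3) v_j + (1/6) v_{j+1} = (u_{j+1} - u_{j-1})/(2h)` for
`1 ≤ j ≤ N-1`. -/
def IsHermDeriv (N : ℕ) (u v : ℕ → ℝ) : Prop :=
  v 0 = 0 ∧ v N = 0 ∧
  ∀ j : ℕ, 1 ≤ j → j ≤ N - 1 →
    (1/6) * v (j-1) + (2/3) * v j + (1/6) * v (j+1)
      = (u (j+1) - u (j-1)) / (2 * ((1:ℝ)/N))

/-- `IsSpline N f s`: `s` is a type-I cubic spline for the data `f` on the uniform grid
`x_j = j/N`. -/
def IsSpline (N : ℕ) (f : ℕ → ℝ) (s : ℝ → ℝ) : Prop :=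
  ContDiff ℝ 2 s ∧
  (∀ j : ℕ, j < N → ∃ p : Polynomial ℝ, p.degree ≤ 3 ∧
      ∀ x ∈ Set.Icc ((j : ℝ) / N) (((j : ℝ) + 1) / N), s x = p.eval x) ∧
  (∀ j : ℕ, j ≤ N → s ((j : ℝ) / N) = f j) ∧
  s 0 = 0 ∧ deriv s 0 = 0 ∧ s 1 = 0 ∧ deriv s 1 = 0

/-- Two differentiable functions agreeing on a nondegenerate closed interval have the same
derivative there, endpoints included. -/
lemma deriv_eq_of_eqOn_Icc {f g : ℝ → ℝ} {a b : ℝ} (hab : a < b) (hf : Differentiable ℝ f)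
    (hg : Differentiable ℝ g) (h : ∀ x ∈ Icc a b, f x = g x) :
    ∀ x ∈ Icc a b, deriv f x = deriv g x := by
  intro x hx
  have hu := uniqueDiffOn_Icc hab x hx
  rw [← (hf x).derivWithin hu, ← (hg x).derivWithin hu]
  exact derivWithin_congr h (h x hx)

/-- The endpoint second derivatives of a cubic polynomial in terms of its endpoint values and
endpoint first derivatives. -/
lemma Polynomial.cubic_second_derivative_eval {p : Polynomial ℝ} (hp : p.degree ≤ 3) (a b : ℝ) :
    (b - a) ^ 2 * p.derivative.derivative.eval b
      = (b - a) * (2 * p.derivative.eval a + 4 * p.derivative.eval b)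
        - 6 * (p.eval b - p.eval a) := by
  rw [p.as_sum_range_C_mul_X_pow' (n := 4)
    (Nat.lt_succ_of_le (Polynomial.natDegree_le_of_degree_le hp))]
  simp [Finset.sum_range_succ]
  ring

/-- The endpoint second derivatives of a `C²` function that coincides with a cubic polynomial on
`[a, b]`. -/
lemma second_deriv_of_eqOn_cubic {s : ℝ → ℝ} (hs : ContDiff ℝ 2 s) {a b : ℝ} (hab : a < b)
    {p : Polynomial ℝ} (hp : p.degree ≤ 3) (h : ∀ x ∈ Icc a b, s x = p.eval x) :
    (b - a) ^ 2 * deriv (deriv s) b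
        = (b - a) * (2 * deriv s a + 4 * deriv s b) - 6 * (s b - s a) ∧
      (b - a) ^ 2 * deriv (deriv s) a
        = 6 * (s b - s a) - (b - a) * (4 * deriv s a + 2 * deriv s b) := by
  have h1 : ∀ x ∈ Icc a b, deriv s x = p.derivative.eval x := by
    intro x hx
    rw [deriv_eq_of_eqOn_Icc hab (hs.differentiable two_ne_zero) p.differentiable h x hx,
      Polynomial.deriv]
  have h2 : ∀ x ∈ Icc a b, deriv (deriv s) x = p.derivative.derivative.eval x := by
    intro x hx
    have hs' : Differentiable ℝ (deriv s) := hs.differentiable_deriv_two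
    rw [deriv_eq_of_eqOn_Icc hab hs' p.derivative.differentiable h1 x hx, Polynomial.deriv]
  have ha : a ∈ Icc a b := left_mem_Icc.2 hab.le
  have hb : b ∈ Icc a b := right_mem_Icc.2 hab.le
  rw [h2 a ha, h2 b hb, h1 a ha, h1 b hb, h a ha, h b hb]
  constructor
  · exact Polynomial.cubic_second_derivative_eval hp a b
  · linear_combination Polynomial.cubic_second_derivative_eval hp b a

/-- The derivative of the interpolating type-I cubic spline at the grid nodes is the
Hermitian derivative of the grid values: the grid function `j ↦ s'(x_j)` vanishes at the
endpoints and satisfies the Simpson relation defining the Hermitian derivative of `u`. -/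
theorem spline_deriv_eq_hermitian_deriv
    (N : ℕ) (hN : 2 ≤ N) (u : ℕ → ℝ) (hu0 : u 0 = 0) (huN : u N = 0)
    (s : ℝ → ℝ) (hs : IsSpline N u s) :
    IsHermDeriv N u (fun j => deriv s ((j : ℝ) / N)) := by
  obtain ⟨hC, hpoly, hval, -, hd0, -, hd1⟩ := hs
  have hN0 : (0 : ℝ) < N := by exact_mod_cast (by omega : 0 < N)
  refine ⟨by simpa using hd0, by simpa [div_self hN0.ne'] using hd1, ?_⟩
  intro j hj hjN
  obtain ⟨k, rfl⟩ : ∃ k, j = k + 1 := ⟨j - 1, by omega⟩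
  obtain ⟨p, hp, hps⟩ := hpoly k (by omega)
  obtain ⟨q, hq, hqs⟩ := hpoly (k + 1) (by omega)
  have hl := (second_deriv_of_eqOn_cubic hC (by gcongr; linarith) hp hps).1
  have hr := (second_deriv_of_eqOn_cubic hC (by gcongr; linarith) hq hqs).2
  have v0 := hval k (by omega)
  have v1 := hval (k + 1) (by omega)
  have v2 := hval (k + 1 + 1) (by omega)
  simp only [Nat.add_sub_cancel]
  push_cast at *
  have e1 : ((k : ℝ) + 1) / N - k / N = 1 / N := by ring
  have e2 : ((k : ℝ) + 1 + 1) / N - (k + 1) / N = 1 / N := by ring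
  rw [e1, v0, v1] at hl
  rw [e2, v1, v2] at hr
  rw [eq_div_iff (by positivity)]
  linear_combination (hr - hl) / 6
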